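/- Let F be a lattice distribution supported on ℕ with mesh 1 and finite mean μ > 0, and let g(iθ) = E[e^{iθX_1}]. Let f : [−π,π] → ℂ be continuous with f(0) ∈ ℝ and Im(f(θ)) = O(θ) as θ → 0. Then θ ↦ Re( f(θ)/(1 − g(iθ)) ) is integrable on [−π,π] and, as r → 1⁻, ∫_{−π}^{π} Re( f(θ)/(1 − r g(iθ)) ) dθ → ∫_{−π}^{π} Re( f(θ)/(1 − g(iθ)) ) dθ + π f(0)/μ. -/

import Mathlib

open MeasureTheory Filter Complex Set Asymptotics ProbabilityTheory

noncomputable section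

/-- The residue of `f` at `c`: the limit, as `r → 0⁺`, of `(2πi)⁻¹ ∮_{|z-c|=r} f`. -/
def residue (f : ℂ → ℂ) (c : ℂ) : ℂ :=
  limUnder (nhdsWithin 0 (Set.Ioi (0 : ℝ)))
    fun r => (2 * Real.pi * Complex.I)⁻¹ * (∮ z in C(c, r), f z)

/-- `n`-fold convolution power of a measure on `ℝ`. -/
def convPow (F : Measure ℝ) : ℕ → Measure ℝ
  | 0 => Measure.dirac 0
  | n + 1 => Measure.map (fun p : ℝ × ℝ => p.1 + p.2) ((convPow F n).prod F)

/-- Renewal function `U(x) = ∑ₙ F^{*n}((-∞, x])`. -/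
def renewalFn (F : Measure ℝ) (x : ℝ) : ℝ :=
  (∑' n : ℕ, convPow F n (Set.Iic x)).toReal

/-- Complex moment generating function `g(z) = ∫ e^{zx} dF(x)`. -/
def cmgf (F : Measure ℝ) (z : ℂ) : ℂ :=
  ∫ x, Complex.exp (z * x) ∂F

/-- `F` is lattice with mesh `1`: supported on `ℕ` but not on `hℕ` for any integer `h > 1`. -/
def LatticeMeshOne (F : Measure ℝ) : Prop :=
  F {x : ℝ | ∀ n : ℕ, x ≠ n} = 0 ∧
    ∀ h : ℕ, 2 ≤ h → 0 < F {x : ℝ | ∀ n : ℕ, x ≠ ((h * n : ℕ) : ℝ)}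

/-- Condition (A) at level `R₀`:
`limsup_{θ→±∞} sup_{0 ≤ r ≤ R₀} |1/(1 - g(r+iθ))| < ∞`, phrased as an eventual
uniform lower bound on `‖1 - g(r+iθ)‖`. -/
def CondA (g : ℂ → ℂ) (R₀ : ℝ) : Prop :=
  ∃ C > (0:ℝ), ∀ᶠ θ : ℝ in (Filter.atTop ⊔ Filter.atBot),
    ∀ r ∈ Set.Icc (0:ℝ) R₀, 1 ≤ C * ‖1 - g ((r : ℂ) + (θ : ℂ) * Complex.I)‖

lemma aux_integrable_exp (F : Measure ℝ) [IsProbabilityMeasure F] (θ : ℝ) :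
    Integrable (fun x : ℝ => Complex.exp ((θ : ℂ) * Complex.I * x)) F := by
  refine Integrable.of_bound (C := 1) (by fun_prop) (ae_of_all _ fun x => ?_)
  have : ((θ : ℂ) * Complex.I * x) = ((θ * x : ℝ) : ℂ) * Complex.I := by push_cast; ring
  rw [this, Complex.norm_exp_ofReal_mul_I]

lemma aux_norm_le (F : Measure ℝ) [IsProbabilityMeasure F] (θ : ℝ) :
    ‖cmgf F ((θ : ℂ) * Complex.I)‖ ≤ 1 := by
  unfold cmgf
  refine (norm_integral_le_of_norm_le_const (C := 1) (ae_of_all _ fun x => ?_)).trans (by simp)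
  have : ((θ : ℂ) * Complex.I * x) = ((θ * x : ℝ) : ℂ) * Complex.I := by push_cast; ring
  rw [this, Complex.norm_exp_ofReal_mul_I]

lemma aux_hasDeriv (F : Measure ℝ) [IsProbabilityMeasure F]
    (hint : Integrable (fun x : ℝ => x) F) (θ : ℝ) :
    HasDerivAt (fun θ : ℝ => cmgf F ((θ : ℂ) * Complex.I))
      (∫ x : ℝ, Complex.I * x * Complex.exp ((θ : ℂ) * Complex.I * x) ∂F) θ := by
  unfold cmgf
  refine (hasDerivAt_integral_of_dominated_loc_of_deriv_le (s := Set.univ)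
    (F := fun (θ : ℝ) (x : ℝ) => Complex.exp ((θ : ℂ) * Complex.I * x))
    (F' := fun (θ : ℝ) (x : ℝ) => Complex.I * x * Complex.exp ((θ : ℂ) * Complex.I * x))
    (bound := fun x => ‖x‖) Filter.univ_mem ?_ ?_ ?_ ?_ hint.norm ?_).2
  · exact Filter.Eventually.of_forall fun θ => (aux_integrable_exp F θ).aestronglyMeasurable
  · exact aux_integrable_exp F θ
  · exact Continuous.aestronglyMeasurable (by fun_prop)
  · refine ae_of_all _ fun x t _ => ?_
    have : ((t : ℂ) * Complex.I * x) = ((t * x : ℝ) : ℂ) * Complex.I := by push_cast; ring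
    rw [this, norm_mul, Complex.norm_exp_ofReal_mul_I]
    simp
  · refine ae_of_all _ fun x t _ => ?_
    have h1 : HasDerivAt (fun t : ℝ => (t : ℂ) * Complex.I * x) (Complex.I * x) t := by
      have := ((Complex.ofRealCLM.hasDerivAt (x := t)).mul_const Complex.I).mul_const (x : ℂ)
      simpa using this
    exact h1.cexp.congr_deriv (mul_comm _ _)

lemma aux_zero (F : Measure ℝ) [IsProbabilityMeasure F] :
    cmgf F (((0 : ℝ) : ℂ) * Complex.I) = 1 := by
  simp [cmgf]

lemma aux_hasDeriv_zero (F : Measure ℝ) [IsProbabilityMeasure F]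
    (hint : Integrable (fun x : ℝ => x) F) :
    HasDerivAt (fun θ : ℝ => cmgf F ((θ : ℂ) * Complex.I))
      (Complex.I * ((∫ x, x ∂F : ℝ) : ℂ)) 0 := by
  have := aux_hasDeriv F hint 0
  convert this using 1
  simp only [ofReal_zero, zero_mul, Complex.exp_zero, mul_one]
  rw [integral_const_mul, integral_complex_ofReal]

lemma aux_re (F : Measure ℝ) [IsProbabilityMeasure F] (θ : ℝ) :
    1 - (cmgf F ((θ : ℂ) * Complex.I)).re = ∫ x, (1 - Real.cos (θ * x)) ∂F := by
  have hre : ∀ x : ℝ, (Complex.exp ((θ : ℂ) * Complex.I * x)).re = Real.cos (θ * x) := by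
    intro x
    have : ((θ : ℂ) * Complex.I * x) = ((θ * x : ℝ) : ℂ) * Complex.I := by push_cast; ring
    rw [this, Complex.exp_ofReal_mul_I_re]
  have hi : Integrable (fun x : ℝ => Real.cos (θ * x)) F := by
    refine Integrable.of_bound (C := 1) (by fun_prop) (ae_of_all _ fun x => ?_)
    exact Real.abs_cos_le_one _
  rw [integral_sub (integrable_const _) hi]
  have h2 := integral_re (aux_integrable_exp F θ)
  simp only [RCLike.re_to_complex, hre] at h2
  rw [h2]
  simp [cmgf]

lemma aux_ne_one (F : Measure ℝ) [IsProbabilityMeasure F] (hlat : LatticeMeshOne F)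
    (θ : ℝ) (h0 : θ ≠ 0) (hθ : |θ| ≤ Real.pi) : cmgf F ((θ : ℂ) * Complex.I) ≠ 1 := by
  intro h1
  have h2 := aux_re F θ
  rw [h1] at h2
  simp only [one_re, sub_self] at h2
  have hi : Integrable (fun x : ℝ => 1 - Real.cos (θ * x)) F := by
    refine (integrable_const _).sub (Integrable.of_bound (C := 1) (by fun_prop)
      (ae_of_all _ fun x => ?_))
    exact Real.abs_cos_le_one _
  have h3 := (integral_eq_zero_iff_of_nonneg
    (fun x => by simpa using Real.cos_le_one (θ * x)) hi).1 h2.symm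
  have hN : ∀ᵐ x : ℝ ∂F, ∃ n : ℕ, x = n := by
    have := hlat.1
    rw [ae_iff]
    simpa using this
  let S : AddSubgroup ℤ :=
    { carrier := {n : ℤ | ∃ k : ℤ, (k : ℝ) * (2 * Real.pi) = θ * n}
      zero_mem' := ⟨0, by simp⟩
      add_mem' := by
        rintro a b ⟨k, hk⟩ ⟨l, hl⟩
        exact ⟨k + l, by push_cast; rw [add_mul, hk, hl]; ring⟩
      neg_mem' := by
        rintro a ⟨k, hk⟩
        exact ⟨-k, by push_cast; rw [neg_mul, hk]; ring⟩ }
  have hS : ∀ n : ℤ, n ∈ S ↔ ∃ k : ℤ, (k : ℝ) * (2 * Real.pi) = θ * n := fun n => Iff.rfl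
  have hpi := Real.pi_pos
  have h1S : (1 : ℤ) ∉ S := by
    rw [hS]
    rintro ⟨k, hk⟩
    have hk0 : k ≠ 0 := by
      rintro rfl
      simp at hk
      exact h0 hk.symm
    have : (1 : ℝ) ≤ |(k : ℝ)| := by exact_mod_cast Int.one_le_abs hk0
    have h5 : |(k : ℝ)| * (2 * Real.pi) = |θ| := by
      have := congrArg abs hk
      rw [abs_mul, abs_of_pos (by positivity : 0 < 2 * Real.pi)] at this
      simpa using this
    nlinarith
  obtain ⟨a, ha⟩ := Int.subgroup_cyclic S
  have hmem : ∀ n : ℤ, n ∈ S ↔ a ∣ n := by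
    intro n
    rw [ha, ← AddSubgroup.zmultiples_eq_closure, Int.mem_zmultiples_iff]
  have key : ∃ h : ℕ, 2 ≤ h ∧ ∀ n : ℕ, (n : ℤ) ∈ S → h ∣ n := by
    by_cases ha0 : a = 0
    · refine ⟨2, le_rfl, fun n hn => ?_⟩
      rw [hmem, ha0, zero_dvd_iff] at hn
      simp at hn
      simp [hn]
    · refine ⟨a.natAbs, ?_, fun n hn => ?_⟩
      · by_contra hlt
        have : a.natAbs = 1 := by omega
        apply h1S
        rw [hmem]
        exact Int.natAbs_dvd.1 (by simp [this])
      · rw [hmem] at hn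
        exact Int.natAbs_dvd_natAbs.2 hn
  obtain ⟨h, hh, hdiv⟩ := key
  have h6 := hlat.2 h hh
  have h7 : ∀ᵐ x ∂F, ¬ (∀ n : ℕ, x ≠ ((h * n : ℕ) : ℝ)) := by
    filter_upwards [h3, hN] with x hx ⟨n, hn⟩
    simp only [Pi.zero_apply] at hx
    have hc : Real.cos (θ * x) = 1 := by linarith
    rw [Real.cos_eq_one_iff] at hc
    obtain ⟨k, hk⟩ := hc
    obtain ⟨m, hm⟩ := hdiv n ((hS _).2 ⟨k, by rw [hk, hn]; simp⟩)
    intro hall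
    exact hall m (by rw [hn, hm])
  rw [ae_iff] at h7
  simp only [not_not] at h7
  exact h6.ne' h7

lemma aux_lower (F : Measure ℝ) [IsProbabilityMeasure F] (hlat : LatticeMeshOne F)
    (hint : Integrable (fun x : ℝ => x) F) (hμ : 0 < ∫ x, x ∂F) :
    ∃ c > 0, ∀ θ ∈ Set.Icc (-Real.pi) Real.pi,
      c * |θ| ≤ ‖1 - cmgf F ((θ : ℂ) * Complex.I)‖ := by
  set g : ℝ → ℂ := fun θ => cmgf F ((θ : ℂ) * Complex.I) with hg
  have hd : Differentiable ℝ g := fun θ => (aux_hasDeriv F hint θ).differentiableAt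
  have hcont : ContinuousOn (dslope g 0) (Set.Icc (-Real.pi) Real.pi) := by
    intro θ _
    by_cases h : θ = 0
    · subst h
      exact (continuousAt_dslope_same.2 (hd 0)).continuousWithinAt
    · exact ((continuousAt_dslope_of_ne h).2 (hd θ).continuousAt).continuousWithinAt
  have hpi := Real.pi_pos
  obtain ⟨t, ht, hmin⟩ := isCompact_Icc.exists_isMinOn (s := Set.Icc (-Real.pi) Real.pi)
    ⟨0, by constructor <;> linarith⟩ hcont.norm
  have g0 : g 0 = 1 := aux_zero F
  refine ⟨‖dslope g 0 t‖, ?_, fun θ hθ => ?_⟩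
  · rw [gt_iff_lt, norm_pos_iff]
    by_cases h : t = 0
    · subst h
      rw [dslope_same, (aux_hasDeriv_zero F hint).deriv]
      simp [hμ.ne']
    · rw [dslope_of_ne _ h, slope_def_module, g0]
      have := aux_ne_one F hlat t h (abs_le.2 ht)
      simp [h, sub_eq_zero, hg, this]
  · have h1 : ‖dslope g 0 t‖ ≤ ‖dslope g 0 θ‖ := hmin hθ
    have h2 : (θ - 0) • dslope g 0 θ = g θ - g 0 := sub_smul_dslope g 0 θ
    rw [g0, sub_zero] at h2
    have h3 : ‖1 - g θ‖ = |θ| * ‖dslope g 0 θ‖ := by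
      rw [norm_sub_rev, ← h2, norm_smul, Real.norm_eq_abs]
    change _ ≤ ‖1 - g θ‖
    rw [h3, mul_comm]
    gcongr

lemma aux_int_arctan (a : ℝ) (ha : a ≠ 0) :
    Integrable (fun s : ℝ => (1 + (a * s) ^ 2)⁻¹) ∧
      ∫ s : ℝ, (1 + (a * s) ^ 2)⁻¹ = Real.pi / |a| := by
  refine ⟨integrable_inv_one_add_sq.comp_mul_left' ha, ?_⟩
  rw [Measure.integral_comp_mul_left (fun s : ℝ => (1 + s ^ 2)⁻¹) a,
    integral_univ_inv_one_add_sq, abs_inv, smul_eq_mul]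
  ring

lemma aux_cos_bound (u : ℝ) : 1 - Real.cos u ≤ 3 * (u ^ 2 * (1 + u ^ 2)⁻¹) := by
  have h1 := Real.one_sub_sq_div_two_le_cos (x := u)
  have h2 := Real.neg_one_le_cos u
  rw [← div_eq_mul_inv, ← mul_div_assoc, le_div_iff₀ (by positivity)]
  rcases le_total (u ^ 2) 5 with h | h <;> nlinarith [sq_nonneg u]

lemma aux_D_integrable (F : Measure ℝ) [IsProbabilityMeasure F]
    (hint : Integrable (fun x : ℝ => x) F) :
    Integrable (fun θ : ℝ => (1 - (cmgf F ((θ : ℂ) * Complex.I)).re) / θ ^ 2) := by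
  have hprod : Integrable (fun p : ℝ × ℝ => 3 * (p.1 ^ 2 * (1 + (p.1 * p.2) ^ 2)⁻¹))
      (F.prod volume) := by
    refine Integrable.const_mul ?_ 3
    have hm : AEStronglyMeasurable (fun p : ℝ × ℝ => p.1 ^ 2 * (1 + (p.1 * p.2) ^ 2)⁻¹)
      (F.prod volume) := Measurable.aestronglyMeasurable (by fun_prop)
    rw [integrable_prod_iff hm]
    constructor
    · refine ae_of_all _ fun x => ?_
      by_cases hx : x = 0
      · simp [hx]
      · exact (aux_int_arctan x hx).1.const_mul (x ^ 2)
    · refine (hint.norm.const_mul Real.pi).congr (ae_of_all _ fun x => ?_)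
      dsimp only
      have : ∀ y : ℝ, ‖x ^ 2 * (1 + (x * y) ^ 2)⁻¹‖ = x ^ 2 * (1 + (x * y) ^ 2)⁻¹ :=
        fun y => Real.norm_of_nonneg (by positivity)
      simp only [this]
      by_cases hx : x = 0
      · simp [hx]
      · rw [integral_const_mul, (aux_int_arctan x hx).2, Real.norm_eq_abs, ← sq_abs]
        have : |x| ≠ 0 := by simpa using hx
        field_simp
  have hprod2 : Integrable (fun p : ℝ × ℝ => (1 - Real.cos (p.2 * p.1)) / p.2 ^ 2)
      (F.prod volume) := by
    refine hprod.mono' (Measurable.aestronglyMeasurable (by fun_prop)) (ae_of_all _ fun p => ?_)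
    have h0 : 0 ≤ 1 - Real.cos (p.2 * p.1) := by linarith [Real.cos_le_one (p.2 * p.1)]
    rw [Real.norm_of_nonneg (by positivity)]
    by_cases h : p.2 = 0
    · simp [h]; positivity
    · rw [div_le_iff₀ (by positivity)]
      refine (aux_cos_bound _).trans (le_of_eq ?_)
      rw [mul_comm p.2 p.1]
      ring
  refine hprod2.integral_prod_right.congr (ae_of_all _ fun θ => ?_)
  dsimp only
  rw [aux_re, integral_div]

lemma aux_half (g : ℂ) (hg : ‖g‖ ≤ 1) (r : ℝ) (h0 : 0 ≤ r) (h1 : r ≤ 1) :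
    1 - r ≤ ‖1 - (r : ℂ) * g‖ ∧ ‖1 - g‖ ≤ 2 * ‖1 - (r : ℂ) * g‖ := by
  have h2 : ‖(r : ℂ) * g‖ ≤ r := by
    rw [norm_mul, Complex.norm_real, Real.norm_of_nonneg h0]
    nlinarith
  have h3 : 1 - r ≤ ‖1 - (r : ℂ) * g‖ := by
    have := norm_sub_norm_le (1 : ℂ) ((r : ℂ) * g)
    rw [norm_one] at this
    linarith
  refine ⟨h3, ?_⟩
  have h4 : 1 - g = (1 - (r : ℂ) * g) - ((1 - r : ℝ) : ℂ) * g := by push_cast; ring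
  have h5 : ‖((1 - r : ℝ) : ℂ) * g‖ ≤ 1 - r := by
    rw [norm_mul, Complex.norm_real, Real.norm_of_nonneg (by linarith)]
    nlinarith
  calc ‖1 - g‖ ≤ ‖1 - (r : ℂ) * g‖ + ‖((1 - r : ℝ) : ℂ) * g‖ := by rw [h4]; exact norm_sub_le _ _
    _ ≤ _ := by linarith

/-- The regular part of the integrand. -/
def partA (f g : ℝ → ℂ) (r θ : ℝ) : ℝ :=
  ((f θ).re * (r * (1 - (g θ).re)) + (f θ).im * (-(r * (g θ).im))) /
    Complex.normSq (1 - (r : ℂ) * g θ)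

/-- The singular part of the integrand. -/
def partB (f g : ℝ → ℂ) (r θ : ℝ) : ℝ :=
  (1 - r) * (f θ).re / Complex.normSq (1 - (r : ℂ) * g θ)

lemma aux_split (f g : ℝ → ℂ) (r θ : ℝ) :
    (f θ / (1 - (r : ℂ) * g θ)).re = partA f g r θ + partB f g r θ := by
  rw [Complex.div_re, partA, partB]
  simp
  ring

lemma aux_partA_bound (f g : ℝ → ℂ) (c M C : ℝ) (hc : 0 < c)
    (hg1 : ∀ θ, ‖g θ‖ ≤ 1) (hM : ∀ θ, ‖f θ‖ ≤ M) (θ : ℝ) (hθ : θ ≠ 0)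
    (hlow : c * |θ| ≤ ‖1 - g θ‖) (hC : |(f θ).im| ≤ C * |θ|)
    (r : ℝ) (h0 : 0 ≤ r) (h1 : r ≤ 1) :
    ‖partA f g r θ‖ ≤ 4 * M / c ^ 2 * ((1 - (g θ).re) / θ ^ 2) + 2 * C / c := by
  have hθ' : 0 < |θ| := abs_pos.2 hθ
  obtain ⟨h2, h3⟩ := aux_half (g θ) (hg1 θ) r h0 h1
  set w := 1 - (r : ℂ) * g θ with hw
  have hre : 0 ≤ 1 - (g θ).re := by
    have := (Complex.re_le_norm (g θ)).trans (hg1 θ)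
    linarith
  have hwl : c / 2 * |θ| ≤ ‖w‖ := by linarith
  have hwpos : 0 < ‖w‖ := lt_of_lt_of_le (by positivity) hwl
  have hwim : |r * (g θ).im| ≤ ‖w‖ := by
    have := Complex.abs_im_le_norm w
    have e : w.im = -(r * (g θ).im) := by simp [hw]
    rwa [e, abs_neg] at this
  have hM0 : 0 ≤ M := (norm_nonneg _).trans (hM θ)
  have hC0 : 0 ≤ C := by
    by_contra h
    push Not at h
    have := abs_nonneg (f θ).im
    nlinarith
  have hfr : |(f θ).re| ≤ M := (Complex.abs_re_le_norm _).trans (hM θ)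
  rw [partA, ← hw, Complex.normSq_eq_norm_sq, add_div]
  refine (norm_add_le _ _).trans (add_le_add ?_ ?_)
  · rw [Real.norm_eq_abs, abs_div, abs_mul, abs_mul, abs_of_nonneg hre, abs_of_nonneg h0,
      abs_of_nonneg (sq_nonneg ‖w‖)]
    have hsq : c ^ 2 / 4 * θ ^ 2 ≤ ‖w‖ ^ 2 := by
      have : (c / 2 * |θ|) ^ 2 ≤ ‖w‖ ^ 2 := by gcongr
      rw [mul_pow, sq_abs] at this
      linarith
    have hnum : |(f θ).re| * (r * (1 - (g θ).re)) ≤ M * (1 - (g θ).re) := by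
      have : r * (1 - (g θ).re) ≤ 1 - (g θ).re := by nlinarith
      gcongr
    calc |(f θ).re| * (r * (1 - (g θ).re)) / ‖w‖ ^ 2
        ≤ M * (1 - (g θ).re) / (c ^ 2 / 4 * θ ^ 2) := by gcongr
      _ = _ := by field_simp
  · rw [Real.norm_eq_abs, abs_div, abs_mul, abs_neg, abs_of_nonneg (sq_nonneg ‖w‖)]
    calc |(f θ).im| * |r * (g θ).im| / ‖w‖ ^ 2 ≤ (C * |θ|) * ‖w‖ / ‖w‖ ^ 2 := by gcongr
      _ = (C * |θ|) / ‖w‖ := by field_simp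
      _ ≤ (C * |θ|) / (c / 2 * |θ|) := by gcongr
      _ = _ := by field_simp

lemma aux_partA_meas (f g : ℝ → ℂ) (hf : Continuous f) (hg : Continuous g) (r : ℝ) :
    Measurable (partA f g r) := by
  unfold partA
  have := hf.measurable
  have := hg.measurable
  have hn : Measurable Complex.normSq := Complex.continuous_normSq.measurable
  fun_prop

lemma aux_partB_meas (f g : ℝ → ℂ) (hf : Continuous f) (hg : Continuous g) (r : ℝ) :
    Measurable (partB f g r) := by
  unfold partB
  have := hf.measurable
  have := hg.measurable
  have hn : Measurable Complex.normSq := Complex.continuous_normSq.measurable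
  fun_prop

lemma aux_partA_tendsto (f g : ℝ → ℂ) (hf : Continuous f) (hg : Continuous g) (c M C : ℝ)
    (hc : 0 < c)
    (hg1 : ∀ θ, ‖g θ‖ ≤ 1) (hM : ∀ θ, ‖f θ‖ ≤ M)
    (hlow : ∀ θ ∈ Set.Icc (-Real.pi) Real.pi, c * |θ| ≤ ‖1 - g θ‖)
    (hC : ∀ θ ∈ Set.Icc (-Real.pi) Real.pi, |(f θ).im| ≤ C * |θ|)
    (hD : Integrable (fun θ : ℝ => (1 - (g θ).re) / θ ^ 2)) :
    (∀ r ∈ Set.Icc (0 : ℝ) 1,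
      IntervalIntegrable (partA f g r) volume (-Real.pi) Real.pi) ∧
    Tendsto (fun r : ℝ => ∫ θ in (-Real.pi)..Real.pi, partA f g r θ)
      (nhdsWithin 1 (Set.Iio 1)) (nhds (∫ θ in (-Real.pi)..Real.pi, partA f g 1 θ)) := by
  have hpi := Real.pi_pos
  have hne : ∀ᵐ θ : ℝ, θ ≠ 0 := by simp [ae_iff]
  set bound : ℝ → ℝ := fun θ => 4 * M / c ^ 2 * ((1 - (g θ).re) / θ ^ 2) + 2 * C / c with hb
  have hbi : IntervalIntegrable bound volume (-Real.pi) Real.pi :=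
    ((hD.const_mul _).intervalIntegrable).add intervalIntegrable_const
  have hbound : ∀ r ∈ Set.Icc (0 : ℝ) 1, ∀ᵐ θ : ℝ, θ ∈ Set.uIoc (-Real.pi) Real.pi →
      ‖partA f g r θ‖ ≤ bound θ := by
    intro r hr
    filter_upwards [hne] with θ hθ hm
    rw [Set.uIoc_of_le (by linarith)] at hm
    have hm' := Set.Ioc_subset_Icc_self hm
    exact aux_partA_bound f g c M C hc hg1 hM θ hθ (hlow θ hm') (hC θ hm') r hr.1 hr.2
  have hev : ∀ᶠ r : ℝ in nhdsWithin 1 (Set.Iio 1), r ∈ Set.Icc (0 : ℝ) 1 := by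
    filter_upwards [Ioo_mem_nhdsLT (zero_lt_one' ℝ)] with r hr
    exact Set.Ioo_subset_Icc_self hr
  refine ⟨fun r hr => ?_, ?_⟩
  · refine hbi.mono_fun' (aux_partA_meas f g hf hg r).aestronglyMeasurable ?_
    exact (ae_restrict_iff' measurableSet_uIoc).2 (hbound r hr)
  · refine intervalIntegral.tendsto_integral_filter_of_dominated_convergence bound
      (Filter.Eventually.of_forall fun r => (aux_partA_meas f g hf hg r).aestronglyMeasurable)
      (hev.mono hbound) hbi ?_
    filter_upwards [hne] with θ hθ hm
    rw [Set.uIoc_of_le (by linarith)] at hm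
    have hm' := Set.Ioc_subset_Icc_self hm
    have hpos : 0 < ‖1 - g θ‖ :=
      lt_of_lt_of_le (mul_pos hc (abs_pos.2 hθ)) (hlow θ hm')
    have hcont : ContinuousAt (fun r : ℝ => partA f g r θ) 1 := by
      unfold partA
      refine ContinuousAt.div (by fun_prop) ?_ ?_
      · exact Complex.continuous_normSq.continuousAt.comp (by fun_prop)
      · simpa using norm_pos_iff.1 hpos
    exact hcont.tendsto.mono_left nhdsWithin_le_nhds

lemma aux_partB_tendsto (f g : ℝ → ℂ) (hf : Continuous f) (hg : Continuous g) (c M μ : ℝ)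
    (hc : 0 < c) (hμ : 0 < μ) (hg0 : g 0 = 1)
    (hd : HasDerivAt g (Complex.I * (μ : ℂ)) 0)
    (hg1 : ∀ θ, ‖g θ‖ ≤ 1) (hM : ∀ θ, ‖f θ‖ ≤ M)
    (hlow : ∀ θ ∈ Set.Icc (-Real.pi) Real.pi, c * |θ| ≤ ‖1 - g θ‖) :
    Tendsto (fun r : ℝ => ∫ θ in (-Real.pi)..Real.pi, partB f g r θ)
      (nhdsWithin 1 (Set.Iio 1)) (nhds (Real.pi * (f 0).re / μ)) := by
  have hpi := Real.pi_pos
  have hM0 : 0 ≤ M := (norm_nonneg _).trans (hM 0)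
  set K : ℝ → ℝ → ℝ := fun ε s =>
    ε * (Set.Ioc (-Real.pi) Real.pi).indicator (partB f g (1 - ε)) (ε * s) with hK
  have hKmeas : ∀ ε, Measurable (K ε) := by
    intro ε
    have h1 : Measurable ((Set.Ioc (-Real.pi) Real.pi).indicator (partB f g (1 - ε))) :=
      (aux_partB_meas f g hf hg _).indicator measurableSet_Ioc
    exact (h1.comp (measurable_const_mul ε)).const_mul ε
  -- change of variables
  have hcv : ∀ ε : ℝ, 0 < ε →
      ∫ s, K ε s = ∫ θ in (-Real.pi)..Real.pi, partB f g (1 - ε) θ := by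
    intro ε hε
    rw [hK]
    simp only
    rw [integral_const_mul, Measure.integral_comp_mul_left
      ((Set.Ioc (-Real.pi) Real.pi).indicator (partB f g (1 - ε))) ε,
      integral_indicator measurableSet_Ioc, intervalIntegral.integral_of_le (by linarith),
      abs_of_pos (by positivity), smul_eq_mul, mul_inv_cancel_left₀ hε.ne']
  have hKb : ∀ ε ∈ Set.Ioo (0 : ℝ) 1, ∀ s : ℝ,
      ‖K ε s‖ ≤ 2 * M * (1 + (c / 2 * s) ^ 2)⁻¹ := by
    intro ε hε s
    rw [hK]
    simp only
    by_cases hs : ε * s ∈ Set.Ioc (-Real.pi) Real.pi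
    · rw [Set.indicator_of_mem hs, partB]
      obtain ⟨h2, h3⟩ := aux_half (g (ε * s)) (hg1 _) (1 - ε) (by linarith [hε.2])
        (by linarith [hε.1])
      have h4 := hlow _ (Set.Ioc_subset_Icc_self hs)
      rw [abs_mul, abs_of_pos hε.1] at h4
      set w := 1 - ((1 - ε : ℝ) : ℂ) * g (ε * s) with hw
      rw [Complex.normSq_eq_norm_sq]
      have h5 : ε ^ 2 ≤ ‖w‖ ^ 2 := by
        have : ε ≤ ‖w‖ := by linarith
        have := hε.1
        gcongr
      have h6 : (c / 2 * (ε * |s|)) ^ 2 ≤ ‖w‖ ^ 2 := by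
        have : c / 2 * (ε * |s|) ≤ ‖w‖ := by linarith
        have := hε.1
        gcongr
      have h7 : ε ^ 2 * (1 + (c / 2 * s) ^ 2) ≤ 2 * ‖w‖ ^ 2 := by
        have : (c / 2 * (ε * |s|)) ^ 2 = ε ^ 2 * (c / 2 * s) ^ 2 := by
          rw [mul_pow, mul_pow, sq_abs]; ring
        rw [this] at h6
        linarith
      have hε2 : 0 < ε ^ 2 := pow_pos hε.1 2
      have hwpos : 0 < ‖w‖ ^ 2 := lt_of_lt_of_le hε2 h5
      have hfr : |(f (ε * s)).re| ≤ M := (Complex.abs_re_le_norm _).trans (hM _)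
      have e : ε * ((1 - (1 - ε)) * (f (ε * s)).re / ‖w‖ ^ 2)
          = (f (ε * s)).re * (ε ^ 2 / ‖w‖ ^ 2) := by ring
      rw [e, Real.norm_eq_abs, abs_mul, abs_of_pos (by positivity : 0 < ε ^ 2 / ‖w‖ ^ 2)]
      have h8 : ε ^ 2 / ‖w‖ ^ 2 ≤ 2 * (1 + (c / 2 * s) ^ 2)⁻¹ := by
        rw [← div_eq_mul_inv, div_le_div_iff₀ hwpos (by positivity)]
        exact h7
      calc _ ≤ M * (2 * (1 + (c / 2 * s) ^ 2)⁻¹) := by gcongr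
        _ = _ := by ring
    · rw [Set.indicator_of_notMem hs]
      simp only [mul_zero, norm_zero]
      positivity
  have hlim : ∀ s : ℝ, Tendsto (fun ε => K ε s) (nhdsWithin 0 (Set.Ioi 0))
      (nhds ((f 0).re * (1 + (μ * s) ^ 2)⁻¹)) := by
    intro s
    have hεs : Tendsto (fun ε : ℝ => ε * s) (nhdsWithin 0 (Set.Ioi 0)) (nhds 0) := by
      have : Continuous fun ε : ℝ => ε * s := by fun_prop
      have := this.tendsto 0
      rw [zero_mul] at this
      exact this.mono_left nhdsWithin_le_nhds
    have hmem : ∀ᶠ ε : ℝ in nhdsWithin 0 (Set.Ioi 0), ε * s ∈ Set.Ioc (-Real.pi) Real.pi :=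
      hεs.eventually (Ioc_mem_nhds (by linarith) hpi)
    have hd2 : HasDerivAt (fun ε : ℝ => g (ε * s)) (s • (Complex.I * (μ : ℂ))) 0 := by
      have h1 : HasDerivAt (fun ε : ℝ => ε * s) s 0 := by
        simpa using (hasDerivAt_id (0 : ℝ)).mul_const s
      have hd' : HasDerivAt g (Complex.I * (μ : ℂ)) ((0 : ℝ) * s) := by rwa [zero_mul]
      exact hd'.scomp (0 : ℝ) h1
    have hsl : Tendsto (fun ε : ℝ => ε⁻¹ • (g (ε * s) - 1)) (nhdsWithin 0 (Set.Ioi 0))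
        (nhds (s • (Complex.I * (μ : ℂ)))) := by
      have := hd2.tendsto_slope_zero_right
      simpa [hg0] using this
    have hgl : Tendsto (fun ε : ℝ => g (ε * s)) (nhdsWithin 0 (Set.Ioi 0)) (nhds 1) := by
      have := (hg.tendsto 0).comp hεs
      rwa [hg0] at this
    have hfl : Tendsto (fun ε : ℝ => (f (ε * s)).re) (nhdsWithin 0 (Set.Ioi 0))
        (nhds (f 0).re) :=
      ((Complex.continuous_re.comp hf).tendsto 0).comp hεs
    have hw : Tendsto (fun ε : ℝ => Complex.normSq (g (ε * s) - ε⁻¹ • (g (ε * s) - 1)))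
        (nhdsWithin 0 (Set.Ioi 0)) (nhds (1 + (μ * s) ^ 2)) := by
      have h1 := (Complex.continuous_normSq.tendsto _).comp (hgl.sub hsl)
      have e : Complex.normSq (1 - s • (Complex.I * (μ : ℂ))) = 1 + (μ * s) ^ 2 := by
        rw [Complex.normSq_apply]
        simp
        ring
      rw [e] at h1
      exact h1
    have hfin := hfl.mul (hw.inv₀ (by positivity))
    refine hfin.congr' ?_
    filter_upwards [hmem, self_mem_nhdsWithin] with ε hm hε
    have hε' : (0 : ℝ) < ε := hε
    rw [hK]
    simp only
    rw [Set.indicator_of_mem hm, partB]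
    have e : 1 - ((1 - ε : ℝ) : ℂ) * g (ε * s)
        = (ε : ℂ) * (g (ε * s) - ε⁻¹ • (g (ε * s) - 1)) := by
      have : (ε : ℂ) ≠ 0 := by exact_mod_cast hε'.ne'
      rw [Complex.real_smul]
      push_cast
      field_simp
      ring
    rw [e, Complex.normSq_mul, Complex.normSq_ofReal, div_eq_mul_inv, mul_inv, mul_inv]
    field_simp
    ring
  have hint : Tendsto (fun ε => ∫ s, K ε s) (nhdsWithin 0 (Set.Ioi 0))
      (nhds (∫ s : ℝ, (f 0).re * (1 + (μ * s) ^ 2)⁻¹)) := by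
    refine tendsto_integral_filter_of_dominated_convergence
      (fun s => 2 * M * (1 + (c / 2 * s) ^ 2)⁻¹)
      (Filter.Eventually.of_forall fun ε => (hKmeas ε).aestronglyMeasurable) ?_ ?_
      (ae_of_all _ hlim)
    · filter_upwards [Ioo_mem_nhdsGT (zero_lt_one' ℝ)] with ε hε
      exact ae_of_all _ (hKb ε hε)
    · exact (aux_int_arctan (c / 2) (by positivity)).1.const_mul _
  rw [integral_const_mul, (aux_int_arctan μ hμ.ne').2, abs_of_pos hμ] at hint
  have hr : Tendsto (fun r : ℝ => 1 - r) (nhdsWithin 1 (Set.Iio 1)) (nhdsWithin 0 (Set.Ioi 0)) := by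
    refine tendsto_nhdsWithin_iff.2 ⟨?_, ?_⟩
    · have : Continuous fun r : ℝ => 1 - r := by fun_prop
      have := this.tendsto 1
      rw [sub_self] at this
      exact this.mono_left nhdsWithin_le_nhds
    · filter_upwards [self_mem_nhdsWithin] with r hr
      simpa using hr
  have := hint.comp hr
  have e : Real.pi * (f 0).re / μ = (f 0).re * (Real.pi / μ) := by ring
  rw [e]
  refine this.congr' ?_
  filter_upwards [self_mem_nhdsWithin] with r hr
  simp only [Function.comp]
  rw [hcv (1 - r) (by simpa using hr)]
  simp

lemma aux_partB_integrable (f g : ℝ → ℂ) (hf : Continuous f) (hg : Continuous g)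
    (hg1 : ∀ θ, ‖g θ‖ ≤ 1) (r : ℝ) (hr : r ∈ Set.Ioo (0 : ℝ) 1) :
    IntervalIntegrable (partB f g r) volume (-Real.pi) Real.pi := by
  refine Continuous.intervalIntegrable ?_ _ _
  unfold partB
  refine Continuous.div (by fun_prop) (Complex.continuous_normSq.comp (by fun_prop)) fun θ => ?_
  have := (aux_half (g θ) (hg1 θ) r hr.1.le hr.2.le).1
  have h2 : 0 < ‖1 - (r : ℂ) * g θ‖ := lt_of_lt_of_le (by linarith [hr.2]) this
  rw [Complex.normSq_eq_norm_sq]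
  positivity

lemma aux_main (f g : ℝ → ℂ) (hf : Continuous f) (hg : Continuous g) (c M C μ : ℝ)
    (hc : 0 < c) (hμ : 0 < μ) (hg0 : g 0 = 1)
    (hd : HasDerivAt g (Complex.I * (μ : ℂ)) 0)
    (hg1 : ∀ θ, ‖g θ‖ ≤ 1) (hM : ∀ θ, ‖f θ‖ ≤ M)
    (hlow : ∀ θ ∈ Set.Icc (-Real.pi) Real.pi, c * |θ| ≤ ‖1 - g θ‖)
    (hC : ∀ θ ∈ Set.Icc (-Real.pi) Real.pi, |(f θ).im| ≤ C * |θ|)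
    (hD : Integrable (fun θ : ℝ => (1 - (g θ).re) / θ ^ 2)) :
    IntervalIntegrable (fun θ : ℝ => (f θ / (1 - g θ)).re) volume (-Real.pi) Real.pi ∧
    Tendsto (fun r : ℝ => ∫ θ in (-Real.pi)..Real.pi, (f θ / (1 - (r : ℂ) * g θ)).re)
      (nhdsWithin 1 (Set.Iio 1))
      (nhds ((∫ θ in (-Real.pi)..Real.pi, (f θ / (1 - g θ)).re) + Real.pi * (f 0).re / μ)) := by
  obtain ⟨hAi, hAt⟩ := aux_partA_tendsto f g hf hg c M C hc hg1 hM hlow hC hD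
  have hBt := aux_partB_tendsto f g hf hg c M μ hc hμ hg0 hd hg1 hM hlow
  have e1 : (fun θ : ℝ => (f θ / (1 - g θ)).re) = partA f g 1 := by
    funext θ
    have := aux_split f g 1 θ
    simpa [partB] using this
  rw [e1]
  refine ⟨hAi 1 (by simp), (hAt.add hBt).congr' ?_⟩
  filter_upwards [Ioo_mem_nhdsLT (zero_lt_one' ℝ)] with r hr
  simp only [aux_split]
  rw [intervalIntegral.integral_add (hAi r (Set.Ioo_subset_Icc_self hr))
    (aux_partB_integrable f g hf hg hg1 r hr)]

/-- **Lemma (weak convergence of Fourier integrals, lattice case).**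
Let `X₁` have a lattice distribution `F` with mesh 1 and finite mean `μ > 0`, with
characteristic function `g(iθ) = E[e^{iθX₁}]`.  If `f : [-π,π] → ℂ` is continuous with
`f(0) ∈ ℝ` and `Im f(θ) = O(θ)` as `θ → 0`, then `θ ↦ Re(f(θ)/(1 - g(iθ)))` is integrable
on `[-π,π]` and, as `r → 1⁻`,
`∫_{-π}^{π} Re(f(θ)/(1 - r g(iθ))) dθ → ∫_{-π}^{π} Re(f(θ)/(1 - g(iθ))) dθ + π f(0)/μ`. -/
theorem weak_convergence_lemma_lattice
    (F : Measure ℝ) [IsProbabilityMeasure F]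
    (hlat : LatticeMeshOne F)
    (hint : Integrable (fun x : ℝ => x) F)
    (μ : ℝ) (hμ : μ = ∫ x, x ∂F) (hμpos : 0 < μ)
    (f : ℝ → ℂ)
    (hfc : ContinuousOn f (Set.Icc (-Real.pi) Real.pi))
    (hf0 : (f 0).im = 0)
    (hfO : (fun θ : ℝ => (f θ).im) =O[nhds 0] fun θ : ℝ => θ) :
    IntervalIntegrable
      (fun θ : ℝ => (f θ / (1 - cmgf F ((θ : ℂ) * Complex.I))).re)
      volume (-Real.pi) Real.pi ∧
    Tendsto
      (fun r : ℝ => ∫ θ in (-Real.pi)..Real.pi,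
        (f θ / (1 - (r : ℂ) * cmgf F ((θ : ℂ) * Complex.I))).re)
      (nhdsWithin 1 (Set.Iio 1))
      (nhds ((∫ θ in (-Real.pi)..Real.pi,
        (f θ / (1 - cmgf F ((θ : ℂ) * Complex.I))).re) + Real.pi * (f 0).re / μ)) := by
  subst hμ
  have hpi := Real.pi_pos
  have hle : -Real.pi ≤ Real.pi := by linarith
  set f' : ℝ → ℂ := Set.IccExtend hle ((Set.Icc (-Real.pi) Real.pi).domRestrict f) with hf'
  have hf'c : Continuous f' := (continuousOn_iff_continuous_domRestrict.1 hfc).Icc_extend'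
  have hff : ∀ θ ∈ Set.Icc (-Real.pi) Real.pi, f' θ = f θ := by
    intro θ hθ
    rw [hf', Set.IccExtend_of_mem _ _ hθ]
    rfl
  obtain ⟨M, hM⟩ := isCompact_Icc.exists_bound_of_continuousOn hfc
  have hM' : ∀ θ, ‖f' θ‖ ≤ M := by
    intro θ
    rw [hf', Set.IccExtend, Function.comp]
    exact hM _ (Set.projIcc _ _ hle θ).2
  have h0mem : (0 : ℝ) ∈ Set.Icc (-Real.pi) Real.pi := ⟨by linarith, by linarith⟩
  have hM0 : 0 ≤ M := (norm_nonneg _).trans (hM 0 h0mem)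
  have hCex : ∃ C, ∀ θ ∈ Set.Icc (-Real.pi) Real.pi, |(f' θ).im| ≤ C * |θ| := by
    obtain ⟨C1, hC1⟩ := hfO.bound
    obtain ⟨δ, hδ, hball⟩ := Metric.eventually_nhds_iff.1 hC1
    refine ⟨max C1 (M / δ), fun θ hθ => ?_⟩
    rw [hff θ hθ]
    by_cases h : |θ| < δ
    · have := hball (y := θ) (by simpa using h)
      simp only [Real.norm_eq_abs] at this
      refine this.trans ?_
      gcongr
      exact le_max_left _ _
    · push Not at h
      calc |(f θ).im| ≤ M := (Complex.abs_im_le_norm _).trans (hM θ hθ)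
        _ = M / δ * δ := by field_simp
        _ ≤ max C1 (M / δ) * |θ| := by
          gcongr
          exact le_max_right _ _
  obtain ⟨C, hC⟩ := hCex
  obtain ⟨c, hc, hlow⟩ := aux_lower F hlat hint hμpos
  have hgc : Continuous fun θ : ℝ => cmgf F ((θ : ℂ) * Complex.I) :=
    continuous_iff_continuousAt.2 fun θ => (aux_hasDeriv F hint θ).continuousAt
  obtain ⟨h1, h2⟩ := aux_main f' (fun θ : ℝ => cmgf F ((θ : ℂ) * Complex.I)) hf'c hgc c M C
    (∫ x, x ∂F) hc hμpos (aux_zero F) (aux_hasDeriv_zero F hint) (aux_norm_le F) hM' hlow hC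
    (aux_D_integrable F hint)
  have hu : Set.uIcc (-Real.pi) Real.pi = Set.Icc (-Real.pi) Real.pi := Set.uIcc_of_le hle
  refine ⟨h1.congr ?_, ?_⟩
  · intro θ hθ
    rw [Set.uIoc_of_le hle] at hθ
    simp only [hff θ (Set.Ioc_subset_Icc_self hθ)]
  · have e : ∀ r : ℂ, (∫ θ in (-Real.pi)..Real.pi,
        (f' θ / (1 - r * cmgf F ((θ : ℂ) * Complex.I))).re) =
        ∫ θ in (-Real.pi)..Real.pi, (f θ / (1 - r * cmgf F ((θ : ℂ) * Complex.I))).re := by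
      intro r
      refine intervalIntegral.integral_congr fun θ hθ => ?_
      rw [hu] at hθ
      simp only [hff θ hθ]
    have e1 := e 1
    simp only [one_mul] at e1
    simp only [e, e1, hff 0 h0mem] at h2
    exact h2

end
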